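/- arXiv:1311.0132 — 3 statements merged into one kernel-verified Lean document; each statement's English description precedes it below -/
import Mathlib

section
/- For every integer n ≥ 0 there exists a constant C > 0, depending only on n, such that for every real δ > 0 and every integer N ≥ 0 one has ∑_{K ∈ ℤ^{n+1}, ‖K‖₁ > N} e^{−δ‖K‖₁} ≤ (C/δ^{n+1}) (1 + δN)^n e^{−δN}. -/
open scoped BigOperators

/-- A finite set of lattice points on the `ℓ¹`-sphere of radius `m` in `ℤ^{n+1}` has at most
`2 (2m+1)^n` elements: a point is determined by its first `n` coordinates and the sign of
the last one. -/
theorem card_le_of_sum_abs_eq {n m : ℕ} (s : Finset (Fin (n + 1) → ℤ))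
    (hs : ∀ K ∈ s, ∑ i, |K i| = (m : ℤ)) : s.card ≤ 2 * (2 * m + 1) ^ n := by
  classical
  set t : Finset ((Fin n → ℤ) × Bool) :=
    Fintype.piFinset (fun _ : Fin n => Finset.Icc (-(m : ℤ)) m) ×ˢ Finset.univ with ht
  have hcard : t.card = 2 * (2 * m + 1) ^ n := by
    have : ((m : ℤ) + 1 + m).toNat = 2 * m + 1 := by omega
    simp [ht, Finset.card_product, this, mul_comm]
  rw [← hcard]
  refine Finset.card_le_card_of_injOn
    (fun K => (fun i => K i.castSucc, decide (0 ≤ K (Fin.last n)))) ?_ ?_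
  · intro K hK
    simp only [ht, Finset.coe_product, Set.mem_prod, Finset.mem_coe, Fintype.mem_piFinset,
      Finset.mem_Icc, Finset.mem_univ, and_true]
    intro i
    rw [← abs_le, ← hs K hK]
    exact Finset.single_le_sum (f := fun i => |K i|) (fun j _ => abs_nonneg _)
      (Finset.mem_univ i.castSucc)
  · intro K hK L hL h
    simp only [Prod.mk.injEq, decide_eq_decide] at h
    obtain ⟨hinit, hsign⟩ := h
    have hinit' : ∀ i : Fin n, K i.castSucc = L i.castSucc := congrFun hinit
    have hsum := (hs K hK).trans (hs L hL).symm
    simp only [Fin.sum_univ_castSucc, hinit', add_right_inj] at hsum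
    funext i
    refine Fin.lastCases ?_ hinit' i
    rcases abs_eq_abs.mp hsum with h | h <;> omega

theorem one_add_pow_le_exp_half (n : ℕ) {x : ℝ} (hx : 0 ≤ x) :
    (1 + x) ^ n ≤ n.factorial * 2 ^ n * Real.exp (1 / 2) * Real.exp (x / 2) := by
  have h := Real.pow_div_factorial_le_exp ((1 + x) / 2) (by positivity) n
  rw [div_le_iff₀ (by positivity), div_pow, div_le_iff₀ (by positivity), add_div,
    Real.exp_add] at h
  linarith

theorem sum_exp_neg_half_le {δ : ℝ} (hδ : 0 < δ) (s : Finset ℕ) :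
    ∑ j ∈ s, Real.exp (-(δ * (j + 1)) / 2) ≤ 2 / δ := by
  set r := Real.exp (-δ / 2) with hr
  have hr0 : 0 < r := Real.exp_pos _
  have hr1 : r < 1 := by rw [hr, Real.exp_lt_one_iff]; linarith
  have hterm : ∀ j : ℕ, Real.exp (-(δ * (j + 1)) / 2) = r * r ^ j := by
    intro j
    rw [hr, ← Real.exp_nat_mul, ← Real.exp_add]
    ring_nf
  simp only [hterm]
  refine (((summable_geometric_of_lt_one hr0.le hr1).mul_left r).sum_le_tsum s
    (fun j _ => by positivity)).trans ?_
  rw [tsum_mul_left, tsum_geometric_of_lt_one hr0.le hr1, ← div_eq_mul_inv,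
    div_le_div_iff₀ (by linarith) hδ]
  have hinv : Real.exp (δ / 2) * r = 1 := by
    rw [hr, ← Real.exp_add, ← Real.exp_zero]
    ring_nf
  nlinarith [Real.add_one_le_exp (δ / 2)]

/-- The contribution of the sphere of radius `N + 1 + j` decays geometrically in `j`. -/
theorem sphere_weight_le (n N j : ℕ) {δ : ℝ} (hδ : 0 < δ) :
    ((2 * (2 * (N + 1 + j) + 1) ^ n : ℕ) : ℝ) * Real.exp (-δ * (N + 1 + j)) ≤
      2 * 3 ^ n * (n.factorial * 2 ^ n * Real.exp (1 / 2)) / δ ^ n * (1 + δ * N) ^ n *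
        Real.exp (-δ * N) * Real.exp (-(δ * (j + 1)) / 2) := by
  have hcount : ((2 * (2 * (N + 1 + j) + 1) ^ n : ℕ) : ℝ) ≤
      2 * 3 ^ n * ((1 + δ * N) ^ n * (1 + δ * (j + 1)) ^ n) / δ ^ n := by
    have hbase : (2 * (N + 1 + j) + 1) * δ ≤ 3 * ((1 + δ * N) * (1 + δ * (j + 1))) := by
      have hδN : 0 ≤ δ * N := by positivity
      have hδj : 0 ≤ δ * j := by positivity
      have hprod : 0 ≤ δ * N * (δ * (j + 1)) := by positivity
      linarith
    have hpow := pow_le_pow_left₀ (by positivity) hbase n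
    simp only [mul_pow] at hpow
    rw [le_div_iff₀ (by positivity)]
    push_cast
    linarith
  have hexp : Real.exp (-δ * (N + 1 + j)) =
      Real.exp (-δ * N) * Real.exp (-(δ * (j + 1)) / 2) * Real.exp (-(δ * (j + 1)) / 2) := by
    rw [← Real.exp_add, ← Real.exp_add]
    ring_nf
  have hcancel : Real.exp (δ * (j + 1) / 2) * Real.exp (-(δ * (j + 1)) / 2) = 1 := by
    rw [← Real.exp_add, ← Real.exp_zero]
    ring_nf
  calc _ ≤ 2 * 3 ^ n * ((1 + δ * N) ^ n * (n.factorial * 2 ^ n * Real.exp (1 / 2) *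
            Real.exp (δ * (j + 1) / 2))) / δ ^ n * Real.exp (-δ * (N + 1 + j)) := by
        refine mul_le_mul_of_nonneg_right (hcount.trans ?_) (Real.exp_pos _).le
        gcongr
        exact one_add_pow_le_exp_half n (by positivity)
    _ = _ := by
        rw [hexp]
        linear_combination 2 * 3 ^ n * (n.factorial * 2 ^ n * Real.exp (1 / 2)) / δ ^ n *
          (1 + δ * N) ^ n * Real.exp (-δ * N) * Real.exp (-(δ * (j + 1)) / 2) * hcancel

/-- Key counting estimate for the cut-off lemma: for every `n ≥ 0` there is a
constant `C > 0` depending only on `n` such that for all `δ > 0` and all integers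
`N ≥ 0`, `∑_{K ∈ ℤ^{n+1}, ‖K‖₁ > N} e^{−δ‖K‖₁} ≤ (C/δ^{n+1}) (1 + δN)^n e^{−δN}`. -/
theorem stmt_0 (n : ℕ) :
    ∃ C > (0 : ℝ), ∀ δ : ℝ, 0 < δ → ∀ N : ℕ,
      Summable (fun K : {K : Fin (n+1) → ℤ // (N : ℤ) < ∑ i, |K i|} =>
        Real.exp (-δ * ((∑ i, |K.1 i| : ℤ) : ℝ))) ∧
      (∑' K : {K : Fin (n+1) → ℤ // (N : ℤ) < ∑ i, |K i|},
          Real.exp (-δ * ((∑ i, |K.1 i| : ℤ) : ℝ)))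
        ≤ C / δ ^ (n+1) * (1 + δ * N) ^ n * Real.exp (-δ * N) := by
  classical
  set A : ℝ := 2 * 3 ^ n * (n.factorial * 2 ^ n * Real.exp (1 / 2))
  refine ⟨A * 2, by positivity, fun δ hδ N => ?_⟩
  have hfin : ∀ s : Finset {K : Fin (n+1) → ℤ // (N : ℤ) < ∑ i, |K i|},
      ∑ K ∈ s, Real.exp (-δ * ((∑ i, |K.1 i| : ℤ) : ℝ)) ≤
        A * 2 / δ ^ (n+1) * (1 + δ * N) ^ n * Real.exp (-δ * N) := by
    intro s
    let g : {K : Fin (n+1) → ℤ // (N : ℤ) < ∑ i, |K i|} → ℕ :=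
      fun K => (∑ i, |K.1 i|).toNat - N - 1
    have hg : ∀ K, ∑ i, |K.1 i| = ((N + 1 + g K : ℕ) : ℤ) := by
      intro K
      have := K.2
      simp only [g]
      omega
    calc ∑ K ∈ s, Real.exp (-δ * ((∑ i, |K.1 i| : ℤ) : ℝ))
        = ∑ j ∈ s.image g, ∑ K ∈ s with g K = j, Real.exp (-δ * ((∑ i, |K.1 i| : ℤ) : ℝ)) :=
          (Finset.sum_fiberwise_of_maps_to (fun K hK => Finset.mem_image_of_mem g hK) _).symm
      _ ≤ ∑ j ∈ s.image g, A / δ ^ n * (1 + δ * N) ^ n * Real.exp (-δ * N) *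
            Real.exp (-(δ * (j + 1)) / 2) := by
          refine Finset.sum_le_sum fun j _ => ?_
          have hconst : ∀ K ∈ s.filter (fun K => g K = j),
              Real.exp (-δ * ((∑ i, |K.1 i| : ℤ) : ℝ)) = Real.exp (-δ * (N + 1 + j)) := by
            intro K hK
            rw [hg K, (Finset.mem_filter.mp hK).2]
            push_cast
            rfl
          rw [Finset.sum_congr rfl hconst, Finset.sum_const, nsmul_eq_mul]
          refine le_trans ?_ (sphere_weight_le n N j hδ)
          refine mul_le_mul_of_nonneg_right (Nat.cast_le.mpr ?_) (Real.exp_pos _).le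
          rw [← Finset.card_map (Function.Embedding.subtype _)]
          refine card_le_of_sum_abs_eq _ fun K hK => ?_
          obtain ⟨L, hL, rfl⟩ := Finset.mem_map.mp hK
          rw [← (Finset.mem_filter.mp hL).2]
          exact hg L
      _ ≤ A / δ ^ n * (1 + δ * N) ^ n * Real.exp (-δ * N) * (2 / δ) := by
          rw [← Finset.mul_sum]
          gcongr
          exact sum_exp_neg_half_le hδ _
      _ = _ := by
          field_simp
          ring
  exact ⟨summable_of_sum_le (fun _ => (Real.exp_pos _).le) hfin,
    Real.tsum_le_of_sum_le (fun _ => (Real.exp_pos _).le) hfin⟩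
end

section
/- Let n ≥ 0 be an integer, let b > 0, 0 < δ < b, let N ≥ 1 be an integer, M ≥ 0, and let c : ℤ^{n+1} → ℂ satisfy |c(K)| ≤ M e^{−b‖K‖₁} for all K ∈ ℤ^{n+1}. Then there exists a constant C > 0 depending only on n such that for every z ∈ ℂ^{n+1} with |Im z_j| ≤ b − δ for all j, the series ∑_{K ∈ ℤ^{n+1}, ‖K‖₁ > N} c(K) e^{i⟨K,z⟩} converges absolutely and its sum has modulus at most (C/δ)(N + 1/δ)^n e^{−Nδ} M. -/
open scoped BigOperators

/-- The `ℓ¹`-sphere of radius `k` in `ℤ^{n+1}` has at most `2 (2k+1)^n` points. -/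
lemma card_le_of_sum_natAbs_eq (n k : ℕ) (s : Finset (Fin (n+1) → ℤ))
    (hs : ∀ K ∈ s, ∑ i, (K i).natAbs = k) : s.card ≤ 2 * (2 * k + 1) ^ n := by
  classical
  let t : Finset (Bool × (Fin n → ℤ)) :=
    Finset.univ ×ˢ Fintype.piFinset (fun _ => Finset.Icc (-(k : ℤ)) k)
  have ht : t.card = 2 * (2 * k + 1) ^ n := by
    simp only [t, Finset.card_product, Fintype.card_piFinset, Int.card_Icc, Finset.prod_const,
      Finset.card_univ, Fintype.card_bool, Fintype.card_fin]
    congr 2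
    omega
  rw [← ht]
  refine Finset.card_le_card_of_injOn
    (fun K => (decide (0 ≤ K 0), fun i : Fin n => K i.succ)) ?_ ?_
  · intro K hK
    have hK := hs K hK
    simp only [t, Finset.coe_product, Set.mem_prod, Finset.mem_coe, Finset.mem_univ, true_and,
      Fintype.mem_piFinset, Finset.mem_Icc]
    intro i
    have := Finset.single_le_sum (f := fun i => (K i).natAbs) (fun i _ => Nat.zero_le _)
      (Finset.mem_univ i.succ)
    simp only [hK] at this
    omega
  · intro K hK L hL h
    have hK := hs K hK
    have hL := hs L hL
    simp only [Prod.mk.injEq, decide_eq_decide] at h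
    obtain ⟨h0, h1⟩ := h
    have h1 : ∀ i : Fin n, K i.succ = L i.succ := fun i => congrFun h1 i
    rw [Fin.sum_univ_succ] at hK hL
    simp only [h1] at hK
    funext i
    refine Fin.cases ?_ h1 i
    omega

lemma one_add_pow_le_mul_exp_half (n : ℕ) {x : ℝ} (hx : 0 ≤ x) :
    (1 + x) ^ n ≤ (2 ^ n * n.factorial * Real.exp (1 / 2)) * Real.exp (x / 2) := by
  have h := Real.pow_div_factorial_le_exp ((1 + x) / 2) (by positivity) n
  rw [div_le_iff₀ (by positivity), div_pow, div_le_iff₀ (by positivity), add_div,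
    Real.exp_add] at h
  linarith

lemma sum_exp_neg_mul_le {a : ℝ} (ha : 0 < a) (s : Finset ℕ) :
    ∑ t ∈ s, Real.exp (-((t : ℝ) + 1) * a) ≤ 1 / a := by
  have hr : Real.exp (-a) < 1 := by rw [Real.exp_lt_one_iff]; linarith
  have hg := (hasSum_geometric_of_lt_one (Real.exp_pos (-a)).le hr).mul_left (Real.exp (-a))
  have hs := sum_le_hasSum s (fun t _ => by positivity) hg
  have he : ∀ t : ℕ, Real.exp (-((t : ℝ) + 1) * a) = Real.exp (-a) * Real.exp (-a) ^ t := by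
    intro t
    rw [← Real.exp_nat_mul, ← Real.exp_add]
    ring_nf
  simp only [he]
  refine hs.trans ?_
  have h1 : 0 < 1 - Real.exp (-a) := by linarith
  rw [← div_eq_mul_inv, div_le_div_iff₀ h1 ha]
  have h2 := Real.add_one_le_exp a
  have h3 : Real.exp a * Real.exp (-a) = 1 := by rw [← Real.exp_add]; simp
  nlinarith [Real.exp_pos (-a)]

/-- Contribution of the sphere of radius `N + 1 + t` to the tail. -/
lemma sphere_contribution_le (n N t : ℕ) {δ : ℝ} (hδ : 0 < δ) :
    (2 * (2 * (N + 1 + t : ℝ) + 1) ^ n) * Real.exp (-δ * (N + 1 + t)) ≤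
      (2 * 3 ^ n * (2 ^ n * n.factorial * Real.exp (1 / 2))) * ((N : ℝ) + 1 / δ) ^ n *
        Real.exp (-(N : ℝ) * δ) * Real.exp (-((t : ℝ) + 1) * (δ / 2)) := by
  have hN : (0 : ℝ) ≤ N := N.cast_nonneg
  have ht : (0 : ℝ) ≤ t := t.cast_nonneg
  have h1 : (2 * (N + 1 + t : ℝ) + 1) ≤ 3 * (((N : ℝ) + 1 / δ) * (1 + (t + 1) * δ)) := by
    have : ((N : ℝ) + 1 / δ) * (1 + (t + 1) * δ) = N + 1 + t + (1 / δ + N * (t + 1) * δ) := by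
      field_simp
      ring
    rw [this]
    have : 0 ≤ 1 / δ + N * (t + 1) * δ := by positivity
    linarith
  have h2 := one_add_pow_le_mul_exp_half n (x := (t + 1) * δ) (by positivity)
  have he : Real.exp (-δ * (N + 1 + t)) = Real.exp (-(N : ℝ) * δ) *
      Real.exp (-((t : ℝ) + 1) * (δ / 2)) * Real.exp (-((t : ℝ) + 1) * (δ / 2)) := by
    rw [← Real.exp_add, ← Real.exp_add]
    ring_nf
  have h3 : Real.exp ((t + 1) * δ / 2) * Real.exp (-((t : ℝ) + 1) * (δ / 2)) = 1 := by
    rw [← Real.exp_add, ← Real.exp_zero]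
    ring_nf
  have h4 : (2 * (N + 1 + t : ℝ) + 1) ^ n ≤ 3 ^ n * (((N : ℝ) + 1 / δ) ^ n *
      ((2 ^ n * n.factorial * Real.exp (1 / 2)) * Real.exp ((t + 1) * δ / 2))) := by
    refine (pow_le_pow_left₀ (by positivity) h1 n).trans ?_
    rw [mul_pow, mul_pow]
    gcongr
  calc _ ≤ (2 * (3 ^ n * (((N : ℝ) + 1 / δ) ^ n *
      ((2 ^ n * n.factorial * Real.exp (1 / 2)) * Real.exp ((t + 1) * δ / 2))))) *
        Real.exp (-δ * (N + 1 + t)) := by gcongr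
    _ = (2 * 3 ^ n * (2 ^ n * n.factorial * Real.exp (1 / 2))) * ((N : ℝ) + 1 / δ) ^ n *
        Real.exp (-(N : ℝ) * δ) * Real.exp (-((t : ℝ) + 1) * (δ / 2)) *
        (Real.exp ((t + 1) * δ / 2) * Real.exp (-((t : ℝ) + 1) * (δ / 2))) := by
      rw [he]; ring
    _ = _ := by rw [h3, mul_one]

lemma sum_exp_neg_l1_le (n N : ℕ) {δ : ℝ} (hδ : 0 < δ) (s : Finset (Fin (n+1) → ℤ))
    (hs : ∀ K ∈ s, (N : ℤ) < ∑ i, |K i|) :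
    ∑ K ∈ s, Real.exp (-δ * ((∑ i, |K i| : ℤ) : ℝ)) ≤
      (2 * (2 * 3 ^ n * (2 ^ n * n.factorial * Real.exp (1 / 2)))) / δ *
        ((N : ℝ) + 1 / δ) ^ n * Real.exp (-(N : ℝ) * δ) := by
  classical
  have habs : ∀ K : Fin (n+1) → ℤ, (∑ i, |K i| : ℤ) = ((∑ i, (K i).natAbs : ℕ) : ℤ) := by
    intro K
    push_cast
    rfl
  have hg : ∀ K ∈ s, N + 1 + (∑ i, (K i).natAbs - (N + 1)) = ∑ i, (K i).natAbs := by
    intro K hK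
    have := hs K hK
    rw [habs] at this
    omega
  have h1 : ∑ K ∈ s, Real.exp (-δ * ((∑ i, |K i| : ℤ) : ℝ)) =
      ∑ K ∈ s, (fun t : ℕ => Real.exp (-δ * (N + 1 + t)))
        (∑ i, (K i).natAbs - (N + 1)) := by
    refine Finset.sum_congr rfl fun K hK => ?_
    have h : ((∑ i, (K i).natAbs : ℕ) : ℝ) = N + 1 + ((∑ i, (K i).natAbs - (N + 1) : ℕ) : ℝ) := by
      exact_mod_cast (hg K hK).symm
    dsimp only
    rw [← h, habs, Int.cast_natCast]
  rw [h1, Finset.sum_comp (fun t : ℕ => Real.exp (-δ * (N + 1 + t)))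
    (fun K : Fin (n+1) → ℤ => ∑ i, (K i).natAbs - (N + 1))]
  refine le_trans (Finset.sum_le_sum (g := fun t : ℕ =>
    (2 * 3 ^ n * (2 ^ n * n.factorial * Real.exp (1 / 2))) * ((N : ℝ) + 1 / δ) ^ n *
      Real.exp (-(N : ℝ) * δ) * Real.exp (-((t : ℝ) + 1) * (δ / 2))) fun t _ => ?_) ?_
  · refine le_trans ?_ (sphere_contribution_le n N t hδ)
    rw [nsmul_eq_mul]
    gcongr
    have hc := card_le_of_sum_natAbs_eq n (N + 1 + t)
      (s.filter fun K => ∑ i, (K i).natAbs - (N + 1) = t) (by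
        intro K hK
        rw [Finset.mem_filter] at hK
        rw [← hg K hK.1, hK.2])
    exact_mod_cast hc
  · rw [← Finset.mul_sum]
    refine (mul_le_mul_of_nonneg_left (sum_exp_neg_mul_le (half_pos hδ) _)
      (by positivity)).trans_eq ?_
    field_simp

lemma norm_exp_I_mul_sum_le {m : ℕ} (K : Fin m → ℤ) (z : Fin m → ℂ) {r : ℝ}
    (hz : ∀ j, |(z j).im| ≤ r) :
    ‖Complex.exp (Complex.I * ∑ j, (K j : ℂ) * z j)‖ ≤
      Real.exp (r * ((∑ i, |K i| : ℤ) : ℝ)) := by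
  rw [Complex.norm_exp, Real.exp_le_exp, Complex.I_mul_re, Complex.im_sum, ← Finset.sum_neg_distrib]
  push_cast
  rw [Finset.mul_sum]
  refine Finset.sum_le_sum fun j _ => ?_
  refine (le_abs_self _).trans ?_
  simp only [Complex.mul_im, Complex.intCast_re, Complex.intCast_im, zero_mul, add_zero, abs_neg,
    abs_mul]
  rw [mul_comm]
  gcongr
  exact hz j

/-- Lemma on a cut off (Lemma 1): if the Fourier coefficients `c K` decay like
`M e^{−b‖K‖₁}`, then the tail `∑_{‖K‖₁ > N} c(K) e^{i⟨K,z⟩}` converges absolutely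
on the polystrip of width `b − δ` and is bounded by `(C/δ)(N + 1/δ)^n e^{−Nδ} M`
with `C` depending only on `n`. -/
theorem stmt_1 (n : ℕ) :
    ∃ C > (0 : ℝ), ∀ (b δ : ℝ) (N : ℕ) (M : ℝ) (c : (Fin (n+1) → ℤ) → ℂ),
      0 < b → 0 < δ → δ < b → 1 ≤ N → 0 ≤ M →
      (∀ K : Fin (n+1) → ℤ, ‖c K‖ ≤ M * Real.exp (-b * ((∑ i, |K i| : ℤ) : ℝ))) →
      ∀ z : Fin (n+1) → ℂ, (∀ j, |(z j).im| ≤ b - δ) →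
        Summable (fun K : {K : Fin (n+1) → ℤ // (N : ℤ) < ∑ i, |K i|} =>
          ‖c K.1 * Complex.exp (Complex.I * ∑ j, (K.1 j : ℂ) * z j)‖) ∧
        ‖∑' K : {K : Fin (n+1) → ℤ // (N : ℤ) < ∑ i, |K i|},
            c K.1 * Complex.exp (Complex.I * ∑ j, (K.1 j : ℂ) * z j)‖
          ≤ C / δ * ((N : ℝ) + 1/δ) ^ n * Real.exp (-(N : ℝ) * δ) * M := by
  classical
  refine ⟨2 * (2 * 3 ^ n * (2 ^ n * n.factorial * Real.exp (1 / 2))), by positivity, ?_⟩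
  intro b δ N M c hb hδ hδb hN hM hc z hz
  have hterm : ∀ K : Fin (n+1) → ℤ,
      ‖c K * Complex.exp (Complex.I * ∑ j, (K j : ℂ) * z j)‖ ≤
        M * Real.exp (-δ * ((∑ i, |K i| : ℤ) : ℝ)) := by
    intro K
    rw [norm_mul]
    refine (mul_le_mul (hc K) (norm_exp_I_mul_sum_le K z hz) (norm_nonneg _)
      (by positivity)).trans_eq ?_
    rw [mul_assoc, ← Real.exp_add]
    ring_nf
  have hsum : ∀ s : Finset {K : Fin (n+1) → ℤ // (N : ℤ) < ∑ i, |K i|},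
      ∑ K ∈ s, ‖c K.1 * Complex.exp (Complex.I * ∑ j, (K.1 j : ℂ) * z j)‖ ≤
        2 * (2 * 3 ^ n * (2 ^ n * n.factorial * Real.exp (1 / 2))) / δ *
          ((N : ℝ) + 1/δ) ^ n * Real.exp (-(N : ℝ) * δ) * M := by
    intro s
    refine (Finset.sum_le_sum fun K _ => hterm K.1).trans ?_
    rw [← Finset.mul_sum, mul_comm]
    refine mul_le_mul_of_nonneg_right ?_ hM
    have h := sum_exp_neg_l1_le n N hδ (s.map (Function.Embedding.subtype _)) (by
      intro K hK
      obtain ⟨K', -, rfl⟩ := Finset.mem_map.1 hK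
      exact K'.2)
    rwa [Finset.sum_map] at h
  have hS := summable_of_sum_le (fun _ => norm_nonneg _) hsum
  exact ⟨hS, (norm_tsum_le_tsum_norm hS).trans (hS.tsum_le_of_sum_le hsum)⟩
end

section
/- Let n ≥ 1 be an integer and let c̲, c_Λ, c', c'' > 0 satisfy c'' ≤ min(1, c_Λ/2, c̲/(2^{n+1} n · n! c_Λ^{n−1}), c̲/(2^{n+4} n · n! c_Λ^{n−1} c')). Let Λ₂ and E be real n×n matrices, u, w ∈ ℝⁿ, and d ∈ ℝ, with |det Λ₂| ≥ c̲, |(Λ₂)_{ij}| ≤ c_Λ for all i,j, |E_{ij}| ≤ 2c'' for all i,j, |u_i| ≤ 2c'' and |w_i| ≤ 2c'' for all i, and |d| ≥ 1/(2c'). Then the (n+1)×(n+1) block matrix J = [[Λ₂ + E, u],[wᵀ, d]] satisfies |det J| ≥ c̲/(8c'). -/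
open scoped BigOperators

theorem Finset.abs_prod_sub_prod_le {ι : Type*} (s : Finset ι) (a b : ι → ℝ) {B δ : ℝ}
    (hB : 0 ≤ B) (ha : ∀ i, |a i| ≤ B) (hb : ∀ i, |b i| ≤ B) (hδ : ∀ i, |a i - b i| ≤ δ) :
    |∏ i ∈ s, a i - ∏ i ∈ s, b i| ≤ s.card * δ * B ^ (s.card - 1) := by
  classical
  induction s using Finset.induction_on with
  | empty => simp
  | insert j s hj ih =>
    rw [Finset.prod_insert hj, Finset.prod_insert hj, Finset.card_insert_of_notMem hj,
      Nat.add_sub_cancel]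
    have hP : |∏ i ∈ s, a i| ≤ B ^ s.card := by
      rw [Finset.abs_prod]
      exact (Finset.prod_le_prod (fun i _ => abs_nonneg _) fun i _ => ha i).trans_eq
        (Finset.prod_const B)
    have hδ0 : 0 ≤ δ := (abs_nonneg _).trans (hδ j)
    have hpow : (s.card : ℝ) * (B * B ^ (s.card - 1)) = s.card * B ^ s.card := by
      rcases Nat.eq_zero_or_pos s.card with h | h
      · simp [h]
      · rw [← pow_succ', Nat.sub_add_cancel h]
    calc |a j * ∏ i ∈ s, a i - b j * ∏ i ∈ s, b i|
        = |(a j - b j) * ∏ i ∈ s, a i + b j * (∏ i ∈ s, a i - ∏ i ∈ s, b i)| := by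
          congr 1; ring
      _ ≤ |a j - b j| * |∏ i ∈ s, a i| + |b j| * |∏ i ∈ s, a i - ∏ i ∈ s, b i| := by
          rw [← abs_mul, ← abs_mul]; exact abs_add_le _ _
      _ ≤ δ * B ^ s.card + B * (s.card * δ * B ^ (s.card - 1)) := by
          gcongr
          · exact hδ j
          · exact hb j
      _ = ((s.card + 1 : ℕ) : ℝ) * δ * B ^ s.card := by
          push_cast; linear_combination δ * hpow

theorem Matrix.abs_det_sub_det_le {ι : Type*} [Fintype ι] [DecidableEq ι] (M N : Matrix ι ι ℝ)
    {B δ : ℝ} (hB : 0 ≤ B) (hM : ∀ i j, |M i j| ≤ B) (hN : ∀ i j, |N i j| ≤ B)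
    (hδ : ∀ i j, |M i j - N i j| ≤ δ) :
    |M.det - N.det| ≤
      (Fintype.card ι).factorial * (Fintype.card ι * δ * B ^ (Fintype.card ι - 1)) := by
  rw [Matrix.det_apply', Matrix.det_apply', ← Finset.sum_sub_distrib]
  refine (Finset.abs_sum_le_sum_abs _ _).trans ?_
  refine (Finset.sum_le_card_nsmul _ _ (Fintype.card ι * δ * B ^ (Fintype.card ι - 1))
    fun σ _ => ?_).trans (le_of_eq ?_)
  · rw [← mul_sub, abs_mul]
    have hσ : |((Equiv.Perm.sign σ : ℤ) : ℝ)| = 1 := by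
      rcases Int.units_eq_one_or (Equiv.Perm.sign σ) with h | h <;> simp [h]
    rw [hσ, one_mul]
    exact Finset.abs_prod_sub_prod_le Finset.univ _ _ hB (fun i => hM _ _) (fun i => hN _ _)
      fun i => hδ _ _
  · rw [Finset.card_univ, Fintype.card_perm, nsmul_eq_mul]

theorem Matrix.abs_adjugate_le {m : ℕ} (M : Matrix (Fin (m + 1)) (Fin (m + 1)) ℝ) {B : ℝ}
    (hM : ∀ i j, |M i j| ≤ B) (i j : Fin (m + 1)) :
    |M.adjugate i j| ≤ m.factorial * B ^ m := by
  rw [Matrix.adjugate_fin_succ_eq_det_submatrix, abs_mul, abs_pow, abs_neg, abs_one, one_pow,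
    one_mul]
  have h := Matrix.det_le (A := M.submatrix j.succAbove i.succAbove)
    (abv := (AbsoluteValue.abs : AbsoluteValue ℝ ℝ)) (x := B) fun a b => hM _ _
  simpa [nsmul_eq_mul] using h

theorem Matrix.abs_dotProduct_mulVec_le {ι : Type*} [Fintype ι] (A : Matrix ι ι ℝ)
    (u w : ι → ℝ) {K δ : ℝ} (hA : ∀ i j, |A i j| ≤ K) (hu : ∀ i, |u i| ≤ δ)
    (hw : ∀ i, |w i| ≤ δ) :
    |w ⬝ᵥ A.mulVec u| ≤ Fintype.card ι * (δ * (Fintype.card ι * (K * δ))) := by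
  have hv : ∀ i, |A.mulVec u i| ≤ Fintype.card ι * (K * δ) := fun i => by
    refine (Finset.abs_sum_le_sum_abs _ _).trans ?_
    refine (Finset.sum_le_card_nsmul _ _ (K * δ) fun j _ => ?_).trans (le_of_eq ?_)
    · rw [abs_mul]
      exact mul_le_mul (hA i j) (hu j) (abs_nonneg _) ((abs_nonneg _).trans (hA i j))
    · rw [Finset.card_univ, nsmul_eq_mul]
  refine (Finset.abs_sum_le_sum_abs _ _).trans ?_
  refine (Finset.sum_le_card_nsmul _ _ (δ * (Fintype.card ι * (K * δ))) fun i _ => ?_).trans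
    (le_of_eq ?_)
  · rw [abs_mul]
    exact mul_le_mul (hw i) (hv i) (abs_nonneg _) ((abs_nonneg _).trans (hw i))
  · rw [Finset.card_univ, nsmul_eq_mul]

theorem Matrix.det_fromBlocks_border {ι : Type*} [Fintype ι] [DecidableEq ι] (M : Matrix ι ι ℝ)
    (hM : M.det ≠ 0) (u w : ι → ℝ) (d : ℝ) :
    (Matrix.fromBlocks M
      (Matrix.of fun i (_ : Fin 1) => u i)
      (Matrix.of fun (_ : Fin 1) j => w j)
      (Matrix.of fun (_ : Fin 1) (_ : Fin 1) => d)).det =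
      d * M.det - w ⬝ᵥ M.adjugate.mulVec u := by
  let := M.invertibleOfIsUnitDet (isUnit_iff_ne_zero.mpr hM)
  have key : ((Matrix.of fun (_ : Fin 1) j => w j) * M.adjugate *
      (Matrix.of fun i (_ : Fin 1) => u i)) 0 0 = w ⬝ᵥ M.adjugate.mulVec u := by
    rw [Matrix.mul_assoc]
    rfl
  rw [Matrix.det_fromBlocks₁₁, Matrix.invOf_eq_nonsing_inv, Matrix.inv_def, Matrix.det_fin_one,
    Matrix.mul_smul, Matrix.smul_mul, Matrix.sub_apply, Matrix.smul_apply, key,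
    Ring.inverse_eq_inv', smul_eq_mul, Matrix.of_apply]
  field_simp

/-- The lower determinant bound of Proposition 7 (prop:Jacobt): for the
`(n+1)×(n+1)` block matrix `J = [[Λ₂ + E, u],[wᵀ, d]]` with `|det Λ₂| ≥ c̲`,
entries of `Λ₂` bounded by `c_Λ`, entries of `E`, `u`, `w` bounded by `2c''`,
`|d| ≥ 1/(2c')`, and `c''` sufficiently small, one has `|det J| ≥ c̲/(8c')`. -/
theorem stmt_12 (n : ℕ) (hn : 1 ≤ n) (cl cΛ c' c'' : ℝ)
    (hcl : 0 < cl) (hcΛ : 0 < cΛ) (hc' : 0 < c') (hc'' : 0 < c'')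
    (hs1 : c'' ≤ 1) (hs2 : c'' ≤ cΛ / 2)
    (hs3 : c'' ≤ cl / (2 ^ (n + 1) * n * (n.factorial : ℝ) * cΛ ^ (n - 1)))
    (hs4 : c'' ≤ cl / (2 ^ (n + 4) * n * (n.factorial : ℝ) * cΛ ^ (n - 1) * c'))
    (Λ₂ E : Matrix (Fin n) (Fin n) ℝ) (u w : Fin n → ℝ) (d : ℝ)
    (hdet : cl ≤ |Λ₂.det|)
    (hΛ : ∀ i j, |Λ₂ i j| ≤ cΛ)
    (hE : ∀ i j, |E i j| ≤ 2 * c'')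
    (hu : ∀ i, |u i| ≤ 2 * c'')
    (hw : ∀ i, |w i| ≤ 2 * c'')
    (hd : 1 / (2 * c') ≤ |d|) :
    cl / (8 * c') ≤
      |(Matrix.fromBlocks (Λ₂ + E)
          (Matrix.of fun i (_ : Fin 1) => u i)
          (Matrix.of fun (_ : Fin 1) j => w j)
          (Matrix.of fun (_ : Fin 1) (_ : Fin 1) => d)).det| := by
  obtain ⟨m, rfl⟩ : ∃ m, n = m + 1 := ⟨n - 1, by omega⟩
  rw [Nat.add_sub_cancel] at hs3 hs4
  have hM : ∀ i j, |(Λ₂ + E) i j| ≤ 2 * cΛ := fun i j => by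
    rw [Matrix.add_apply]
    linarith [abs_add_le (Λ₂ i j) (E i j), hΛ i j, hE i j]
  have hpert := Matrix.abs_det_sub_det_le (Λ₂ + E) Λ₂ (B := 2 * cΛ) (δ := 2 * c'')
    (by positivity) hM (fun i j => (hΛ i j).trans (by linarith))
    (fun i j => by simpa using hE i j)
  rw [Fintype.card_fin, Nat.add_sub_cancel, mul_pow] at hpert
  rw [le_div_iff₀ (by positivity)] at hs3
  have hdetM : cl / 2 ≤ |(Λ₂ + E).det| := by
    have h : ((m + 1).factorial : ℝ) * (((m + 1 : ℕ) : ℝ) * (2 * c'') * (2 ^ m * cΛ ^ m))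
        ≤ cl / 2 := by
      refine le_trans (le_of_eq ?_) (div_le_div_of_nonneg_right hs3 zero_le_two)
      ring
    have := abs_sub_abs_le_abs_sub Λ₂.det (Λ₂ + E).det
    rw [abs_sub_comm] at this
    linarith
  have hne : (Λ₂ + E).det ≠ 0 := abs_pos.mp (by linarith)
  rw [Matrix.det_fromBlocks_border _ hne]
  have hborder := Matrix.abs_dotProduct_mulVec_le _ u w
    (Matrix.abs_adjugate_le (Λ₂ + E) hM) hu hw
  rw [Fintype.card_fin, mul_pow] at hborder
  have hsmall : |w ⬝ᵥ (Λ₂ + E).adjugate.mulVec u| ≤ cl / (8 * c') := by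
    refine hborder.trans ?_
    rw [le_div_iff₀ (by positivity)] at hs4 ⊢
    refine le_trans (le_of_eq ?_) ((mul_le_of_le_one_left (by positivity) hs1).trans hs4)
    rw [Nat.factorial_succ]
    push_cast
    ring
  have hmain : cl / (4 * c') ≤ |d * (Λ₂ + E).det| := by
    rw [abs_mul]
    calc cl / (4 * c') = 1 / (2 * c') * (cl / 2) := by field_simp; norm_num
      _ ≤ |d| * |(Λ₂ + E).det| := by gcongr
  have hhalf : cl / (4 * c') = cl / (8 * c') + cl / (8 * c') := by field_simp; norm_num
  linarith [abs_sub_abs_le_abs_sub (d * (Λ₂ + E).det) (w ⬝ᵥ (Λ₂ + E).adjugate.mulVec u)]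
end
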